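/- Let x, z, t be elements of A satisfying x·z = q·z·x, z·t = q·t·z and x·t = q·t·x + λ·z², and suppose q is a primitive n-th root of unity with n ≥ 2. Then (x + b·z + t)^n = x^n + ν(n)·z^n + t^n. -/

import Mathlib

/-- The q-integer `(n)_q = 1 + q + ⋯ + q^(n-1)`. -/
def qInt {k : Type*} [Field k] (q : k) (n : ℕ) : k := ∑ i ∈ Finset.range n, q ^ i

/-- The recursively defined sequence `ν(0) = 1`, `ν(1) = b`,
`ν(n) = b·ν(n-1) + λ·(n-1)_q·ν(n-2)`. -/
def nuSeq {k : Type*} [Field k] (q b lam : k) : ℕ → k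
  | 0 => 1
  | 1 => b
  | n + 2 => b * nuSeq q b lam (n + 1) + lam * qInt q (n + 1) * nuSeq q b lam n

section QBinomial

variable {k : Type*} [Field k]

theorem qInt_zero (q : k) : qInt q 0 = 0 := by simp [qInt]

theorem qInt_one (q : k) : qInt q 1 = 1 := by simp [qInt]

theorem qInt_add (q : k) (m n : ℕ) : qInt q (m + n) = qInt q m + q ^ m * qInt q n := by
  simp only [qInt, Finset.sum_range_add, pow_add, Finset.mul_sum]

theorem qInt_succ (q : k) (n : ℕ) : qInt q (n + 1) = qInt q n + q ^ n := by
  rw [qInt_add, qInt_one, mul_one]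

theorem qInt_mul_sub_one (q : k) (n : ℕ) : qInt q n * (q - 1) = q ^ n - 1 :=
  geom_sum_mul q n

/-- The Gaussian binomial coefficient, defined through the `q`-Pascal rule. -/
def qChoose (q : k) : ℕ → ℕ → k
  | _, 0 => 1
  | 0, _ + 1 => 0
  | n + 1, j + 1 => qChoose q n j + q ^ (j + 1) * qChoose q n (j + 1)

theorem qChoose_zero_right (q : k) (n : ℕ) : qChoose q n 0 = 1 := by
  cases n <;> rfl

theorem qChoose_succ_succ (q : k) (n j : ℕ) :
    qChoose q (n + 1) (j + 1) = qChoose q n j + q ^ (j + 1) * qChoose q n (j + 1) := rfl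

theorem qChoose_eq_zero_of_lt (q : k) {n j : ℕ} (h : n < j) : qChoose q n j = 0 := by
  induction n generalizing j with
  | zero =>
    obtain ⟨j, rfl⟩ := Nat.exists_eq_succ_of_ne_zero h.ne'
    rfl
  | succ n ih =>
    obtain ⟨j, rfl⟩ := Nat.exists_eq_succ_of_ne_zero (Nat.ne_zero_of_lt h)
    rw [Nat.succ_eq_add_one, qChoose_succ_succ, ih (by omega), ih (by omega)]
    ring

theorem qChoose_self (q : k) (n : ℕ) : qChoose q n n = 1 := by
  induction n with
  | zero => rfl
  | succ n ih => rw [qChoose_succ_succ, ih, qChoose_eq_zero_of_lt q n.lt_succ_self]; ring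

theorem qInt_succ_mul_qChoose_aux (q : k) {n j : ℕ}
    (h : qInt q (j + 1) * qChoose q n (j + 1) = qInt q (n - j) * qChoose q n j) :
    qInt q (j + 1) * qChoose q (n + 1) (j + 1) = qInt q (n + 1) * qChoose q n j := by
  rcases le_or_gt j n with hj | hj
  · have e : qInt q (n + 1) = qInt q (j + 1) + q ^ (j + 1) * qInt q (n - j) := by
      rw [← qInt_add]; congr 1; omega
    rw [qChoose_succ_succ, e]
    linear_combination q ^ (j + 1) * h
  · rw [qChoose_eq_zero_of_lt q hj, qChoose_eq_zero_of_lt q (by omega)]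
    ring

theorem qInt_succ_mul_qChoose_succ_right (q : k) (n j : ℕ) :
    qInt q (j + 1) * qChoose q n (j + 1) = qInt q (n - j) * qChoose q n j := by
  induction n generalizing j with
  | zero => simp [qInt_zero, qChoose_eq_zero_of_lt q j.succ_pos]
  | succ n ih =>
    rw [qInt_succ_mul_qChoose_aux q (ih j)]
    cases j with
    | zero => simp [qChoose_zero_right]
    | succ j =>
      rw [Nat.add_sub_add_right, qChoose_succ_succ]
      rcases le_or_gt j n with hj | hj
      · have e : qInt q (n + 1) = qInt q (j + 1) + q ^ (j + 1) * qInt q (n - j) := by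
          rw [← qInt_add]; congr 1; omega
        rw [e]
        linear_combination ih j
      · rw [qChoose_eq_zero_of_lt q hj, qChoose_eq_zero_of_lt q (by omega)]
        ring

theorem qInt_succ_mul_qChoose_succ_succ (q : k) (n j : ℕ) :
    qInt q (j + 1) * qChoose q (n + 1) (j + 1) = qInt q (n + 1) * qChoose q n j :=
  qInt_succ_mul_qChoose_aux q (qInt_succ_mul_qChoose_succ_right q n j)

theorem qChoose_eq_zero_of_primitive {q : k} {n : ℕ} (hn : 2 ≤ n) (hq1 : q ^ n = 1)
    (hq2 : ∀ m : ℕ, 1 ≤ m → m < n → q ^ m ≠ 1) {j : ℕ} (hj : 1 ≤ j) (hjn : j < n) :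
    qChoose q n j = 0 := by
  have hq : q - 1 ≠ 0 := sub_ne_zero.2 (by simpa using hq2 1 le_rfl (by omega))
  have hzero : qInt q n = 0 := by
    have := qInt_mul_sub_one q n
    rw [hq1, sub_self] at this
    exact (mul_eq_zero.1 this).resolve_right hq
  have hne : qInt q j ≠ 0 := fun h0 => by
    have := qInt_mul_sub_one q j
    rw [h0, zero_mul] at this
    exact hq2 j hj hjn (sub_eq_zero.1 this.symm)
  obtain ⟨j, rfl⟩ := Nat.exists_eq_add_of_le' hj
  obtain ⟨n, rfl⟩ := Nat.exists_eq_add_of_le' (show 1 ≤ n by omega)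
  have := qInt_succ_mul_qChoose_succ_succ q n j
  rw [hzero, zero_mul] at this
  exact (mul_eq_zero.1 this).resolve_left hne

theorem nuSeq_succ (q b lam : k) (n : ℕ) :
    nuSeq q b lam (n + 1) =
      b * nuSeq q b lam n + lam * qInt q n * nuSeq q b lam (n - 1) := by
  cases n with
  | zero => simp [nuSeq, qInt_zero]
  | succ n => rfl

variable {M : Type*} [AddCommGroup M] [Module k M]

theorem sum_qChoose_succ_smul (q : k) (n : ℕ) (f : ℕ → M) :
    ∑ j ∈ Finset.range (n + 2), qChoose q (n + 1) j • f j =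
      ∑ j ∈ Finset.range (n + 1), qChoose q n j • (f (j + 1) + q ^ j • f j) := by
  have h : ∑ j ∈ Finset.range (n + 1), (q ^ (j + 1) * qChoose q n (j + 1)) • f (j + 1) + f 0 =
      ∑ j ∈ Finset.range (n + 1), (q ^ j * qChoose q n j) • f j := by
    have := Finset.sum_range_succ' (fun j => (q ^ j * qChoose q n j) • f j) (n + 1)
    rw [Finset.sum_range_succ, qChoose_eq_zero_of_lt q n.lt_succ_self] at this
    simpa [qChoose_zero_right] using this.symm
  rw [Finset.sum_range_succ']
  simp only [qChoose_succ_succ, qChoose_zero_right, add_smul, one_smul, smul_add,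
    Finset.sum_add_distrib, add_assoc, h, smul_smul]
  simp only [mul_comm]

theorem sum_qChoose_smul_qInt_smul (q : k) (n : ℕ) (f : ℕ → M) :
    ∑ j ∈ Finset.range (n + 1), qChoose q n j • qInt q j • f j =
      ∑ j ∈ Finset.range (n + 1), qChoose q n j • qInt q (n - j) • f (j + 1) := by
  rw [Finset.sum_range_succ', Finset.sum_range_succ]
  simp only [qInt_zero, Nat.sub_self, zero_smul, smul_zero, add_zero, smul_smul]
  refine Finset.sum_congr rfl fun j _ => ?_
  rw [mul_comm, qInt_succ_mul_qChoose_succ_right, mul_comm]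

theorem sum_qChoose_smul_of_primitive {q : k} {n : ℕ} (hn : 2 ≤ n) (hq1 : q ^ n = 1)
    (hq2 : ∀ m : ℕ, 1 ≤ m → m < n → q ^ m ≠ 1) (f : ℕ → M) :
    ∑ j ∈ Finset.range (n + 1), qChoose q n j • f j = f 0 + f n := by
  obtain ⟨m, rfl⟩ := Nat.exists_eq_add_of_le' (show 1 ≤ n by omega)
  rw [Finset.sum_range_succ, Finset.sum_range_succ', Finset.sum_eq_zero, qChoose_self,
    qChoose_zero_right, one_smul, one_smul, zero_add]
  intro j hj
  rw [qChoose_eq_zero_of_primitive hn hq1 hq2 (by omega)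
    (by have := Finset.mem_range.1 hj; omega), zero_smul]

end QBinomial

section NormalOrdering

variable {k A : Type*} [Field k] [Ring A] [Algebra k A]

theorem mul_pow_of_q_commute {q : k} {u v : A} (h : u * v = q • (v * u)) (n : ℕ) :
    u * v ^ n = q ^ n • (v ^ n * u) := by
  induction n with
  | zero => simp
  | succ n ih =>
    rw [pow_succ, ← mul_assoc, ih, smul_mul_assoc, mul_assoc, h, mul_smul_comm, smul_smul,
      ← pow_succ, mul_assoc]

theorem mul_pow_of_q_commute_add {q lam : k} {x z t : A} (hzt : z * t = q • (t * z))
    (hxt : x * t = q • (t * x) + lam • z ^ 2) (n : ℕ) :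
    x * t ^ n = q ^ n • (t ^ n * x) +
      qInt q n • (lam * q ^ (n - 1)) • (t ^ (n - 1) * z ^ 2) := by
  have hz2 : z ^ 2 * t = (q * q) • (t * z ^ 2) := by
    rw [sq, mul_assoc, hzt, mul_smul_comm, ← mul_assoc, hzt, smul_mul_assoc, smul_smul, mul_assoc]
  induction n with
  | zero => simp [qInt_zero]
  | succ n ih =>
    have hpow : qInt q n • (lam * q ^ (n - 1)) • (t ^ (n - 1) * (t * z ^ 2)) * (1 : A) =
        qInt q n • (lam * q ^ (n - 1)) • (t ^ n * z ^ 2) := by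
      cases n with
      | zero => simp [qInt_zero]
      | succ n => simp [pow_succ, mul_assoc]
    have hq : q * (qInt q n * (lam * q ^ (n - 1))) = qInt q n * (lam * q ^ n) := by
      cases n with
      | zero => simp [qInt_zero]
      | succ n => simp [pow_succ]; ring
    have hc : qInt q (n + 1) = 1 + q * qInt q n := by
      rw [add_comm, qInt_add, qInt_one, pow_one]
    rw [mul_one] at hpow
    rw [pow_succ, ← mul_assoc, ih, add_mul, smul_mul_assoc, mul_assoc, hxt]
    simp only [smul_mul_assoc, mul_assoc, hz2, mul_add, mul_smul_comm, smul_add]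
    rw [smul_comm (lam * q ^ (n - 1)) (q * q), smul_comm (qInt q n) (q * q), hpow]
    simp only [Nat.add_sub_cancel, smul_smul, pow_succ, mul_assoc]
    rw [add_assoc, ← add_smul]
    congr 2
    rw [hc]
    linear_combination q * hq

/-- The part of `(x + b • z + t) ^ n` free of `t` after moving all `t` to the left. -/
def tFreePart (q b lam : k) (x z : A) : ℕ → A
  | 0 => 1
  | 1 => x + b • z
  | n + 2 => (x + b • z) * tFreePart q b lam x z (n + 1) +
      (lam * qInt q (n + 1)) • (z ^ 2 * tFreePart q b lam x z n)

theorem tFreePart_succ (q b lam : k) (x z : A) (n : ℕ) :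
    tFreePart q b lam x z (n + 1) = (x + b • z) * tFreePart q b lam x z n +
      (lam * qInt q n) • (z ^ 2 * tFreePart q b lam x z (n - 1)) := by
  cases n with
  | zero => simp [tFreePart, qInt_zero]
  | succ n => rfl

theorem add_smul_add_pow_eq_sum {q lam : k} (b : k) {x z t : A} (hzt : z * t = q • (t * z))
    (hxt : x * t = q • (t * x) + lam • z ^ 2) (n : ℕ) :
    (x + b • z + t) ^ n =
      ∑ j ∈ Finset.range (n + 1), qChoose q n j • (t ^ j * tFreePart q b lam x z (n - j)) := by
  induction n with
  | zero => simp [qChoose_zero_right, tFreePart]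
  | succ n ih =>
    have hmul (j : ℕ) : (x + b • z + t) * (t ^ j * tFreePart q b lam x z (n - j)) =
        (t ^ (j + 1) * tFreePart q b lam x z (n - j) +
          q ^ j • (t ^ j * ((x + b • z) * tFreePart q b lam x z (n - j)))) +
        qInt q j • ((lam * q ^ (j - 1)) •
          (t ^ (j - 1) * (z ^ 2 * tFreePart q b lam x z (n - j)))) := by
      rw [← mul_assoc, add_mul, add_mul x, mul_pow_of_q_commute_add hzt hxt, smul_mul_assoc,
        mul_pow_of_q_commute hzt, ← pow_succ']
      simp only [add_mul, mul_add, smul_mul_assoc, mul_smul_comm, mul_assoc, smul_add,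
        smul_comm b (q ^ j)]
      abel
    rw [pow_succ', ih, Finset.mul_sum, sum_qChoose_succ_smul]
    simp only [mul_smul_comm, hmul]
    simp only [smul_add (qChoose q n _) (_ + _) (qInt q _ • _), Finset.sum_add_distrib]
    rw [sum_qChoose_smul_qInt_smul q n fun j => (lam * q ^ (j - 1)) •
          (t ^ (j - 1) * (z ^ 2 * tFreePart q b lam x z (n - j))), ← Finset.sum_add_distrib]
    refine Finset.sum_congr rfl fun j hj => ?_
    have hj' : n + 1 - j = (n - j) + 1 := by have := Finset.mem_range.1 hj; omega
    rw [← smul_add, hj', tFreePart_succ, Nat.add_sub_add_right n 1 j, Nat.add_sub_cancel, Nat.sub_sub,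
      add_assoc]
    congr 2
    rw [mul_add, smul_add, mul_smul_comm, smul_smul, smul_smul]
    congr 2
    ring

theorem tFreePart_eq_sum {q : k} (b lam : k) {x z : A} (hxz : x * z = q • (z * x)) (n : ℕ) :
    tFreePart q b lam x z n =
      ∑ j ∈ Finset.range (n + 1),
        qChoose q n j • nuSeq q b lam j • (z ^ j * x ^ (n - j)) := by
  induction n using Nat.strong_induction_on with
  | _ n ih =>
  cases n with
  | zero => simp [tFreePart, qChoose_zero_right, nuSeq]
  | succ n =>
    have hlow : (lam * qInt q n) • (z ^ 2 * tFreePart q b lam x z (n - 1)) =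
        ∑ j ∈ Finset.range (n + 1), qChoose q n j • qInt q j •
          (lam * nuSeq q b lam (j - 1)) • (z ^ (j + 1) * x ^ (n - j)) := by
      cases n with
      | zero => simp [qInt_zero]
      | succ n =>
        rw [Finset.sum_range_succ', Nat.add_sub_cancel, ih n (by omega), Finset.mul_sum,
          Finset.smul_sum, qInt_zero, zero_smul, smul_zero, add_zero]
        refine Finset.sum_congr rfl fun j _ => ?_
        rw [Nat.add_sub_cancel, Nat.add_sub_add_right, mul_smul_comm, mul_smul_comm, ← mul_assoc,
          ← pow_add, add_comm 2 j]
        simp only [smul_smul]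
        congr 1
        linear_combination
          -lam * nuSeq q b lam j * qInt_succ_mul_qChoose_succ_succ q n j
    rw [tFreePart_succ, hlow, ih n n.lt_succ_self, sum_qChoose_succ_smul, Finset.mul_sum,
      ← Finset.sum_add_distrib]
    refine Finset.sum_congr rfl fun j hj => ?_
    have hj' : n + 1 - j = (n - j) + 1 := by have := Finset.mem_range.1 hj; omega
    rw [mul_smul_comm, ← smul_add, Nat.add_sub_add_right, hj', nuSeq_succ, mul_smul_comm,
      add_mul, ← mul_assoc, mul_pow_of_q_commute hxz, smul_mul_assoc, smul_mul_assoc, mul_assoc,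
      ← pow_succ', ← mul_assoc, ← pow_succ']
    module

end NormalOrdering

theorem generalized_q_binomial_primitive_root {k A : Type*} [Field k] [Ring A] [Algebra k A]
    (q : k) (lam b : k) (n : ℕ) (hn : 2 ≤ n)
    (hq1 : q ^ n = 1) (hq2 : ∀ m : ℕ, 1 ≤ m → m < n → q ^ m ≠ 1)
    (x z t : A)
    (hxz : x * z = q • (z * x)) (hzt : z * t = q • (t * z))
    (hxt : x * t = q • (t * x) + lam • z ^ 2) :
    (x + b • z + t) ^ n = x ^ n + nuSeq q b lam n • z ^ n + t ^ n := by
  rw [add_smul_add_pow_eq_sum b hzt hxt, sum_qChoose_smul_of_primitive hn hq1 hq2,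
    Nat.sub_zero, tFreePart_eq_sum b lam hxz, sum_qChoose_smul_of_primitive hn hq1 hq2]
  simp [nuSeq, tFreePart]
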